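/- arXiv:1811.10359 — 3 statements merged into one kernel-verified Lean document; each statement's English description precedes it below -/
import Mathlib

section
/- Let r ∈ ℤ with r ≥ 2 and let v : SL(2,ℤ) → ℂˣ be a group homomorphism with v(−I) = (−1)^r. Let V be the ℂ-vector space of polynomial functions ℂ → ℂ of degree at most r−2, equipped with the right SL(2,ℤ)-action (p|γ)(t) := v(γ)·(ct+d)^{r−2}·p((at+b)/(ct+d)) for γ = [[a,b],[c,d]] ∈ SL(2,ℤ) (for p of degree at most r−2 this is again a polynomial function of degree at most r−2). Let W ⊆ V be the linear span of all elements p − p|S and p − p|T with p ∈ V. Then the quotient space V/W is one-dimensional if r = 2 and v is the trivial homomorphism, and V/W = 0 in all other cases. -/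
open Polynomial

noncomputable section

/-- The space of polynomial functions `ℂ → ℂ` of degree at most `d`,
as a submodule of the space of all functions `ℂ → ℂ`. -/
def polyFuns (d : ℕ) : Submodule ℂ (ℂ → ℂ) where
  carrier := {f | ∃ p : Polynomial ℂ, p.degree ≤ (d : WithBot ℕ) ∧ f = fun t => p.eval t}
  add_mem' := by
    rintro f g ⟨p, hp, rfl⟩ ⟨q, hq, rfl⟩
    exact ⟨p + q, le_trans (Polynomial.degree_add_le p q) (max_le hp hq),
      by funext t; simp⟩
  zero_mem' := ⟨0, by simp, by funext t; simp⟩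
  smul_mem' := by
    rintro c f ⟨p, hp, rfl⟩
    exact ⟨c • p, le_trans (Polynomial.degree_smul_le c p) hp, by funext t; simp⟩

/-- `S = [[0,−1],[1,0]]`. -/
def Smat : Matrix.SpecialLinearGroup (Fin 2) ℤ :=
  ⟨!![0, -1; 1, 0], by simp [Matrix.det_fin_two_of]⟩

/-- `T = [[1,1],[0,1]]`. -/
def Tmat : Matrix.SpecialLinearGroup (Fin 2) ℤ :=
  ⟨!![1, 1; 0, 1], by simp [Matrix.det_fin_two_of]⟩

/-- `−I`. -/
def negI : Matrix.SpecialLinearGroup (Fin 2) ℤ :=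
  ⟨!![-1, 0; 0, -1], by simp [Matrix.det_fin_two_of]⟩

/-- The weight-`(2−r)`-type right action `(p|γ)(t) = v(γ)·(ct+d)^{r−2}·p((at+b)/(ct+d))`. -/
def slAct (r : ℤ) (v : Matrix.SpecialLinearGroup (Fin 2) ℤ →* ℂˣ)
    (γ : Matrix.SpecialLinearGroup (Fin 2) ℤ) (f : ℂ → ℂ) : ℂ → ℂ :=
  fun t =>
    ((v γ : ℂˣ) : ℂ) *
      ((((γ : Matrix (Fin 2) (Fin 2) ℤ) 1 0 : ℤ) : ℂ) * t +
        (((γ : Matrix (Fin 2) (Fin 2) ℤ) 1 1 : ℤ) : ℂ)) ^ (r - 2) *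
      f (((((γ : Matrix (Fin 2) (Fin 2) ℤ) 0 0 : ℤ) : ℂ) * t +
            (((γ : Matrix (Fin 2) (Fin 2) ℤ) 0 1 : ℤ) : ℂ)) /
          ((((γ : Matrix (Fin 2) (Fin 2) ℤ) 1 0 : ℤ) : ℂ) * t +
            (((γ : Matrix (Fin 2) (Fin 2) ℤ) 1 1 : ℤ) : ℂ)))

/-- The span `W` of all elements `p − p|S` and `p − p|T` with `p ∈ V`. -/
def Wspan (r : ℤ) (v : Matrix.SpecialLinearGroup (Fin 2) ℤ →* ℂˣ) :
    Submodule ℂ (ℂ → ℂ) :=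
  Submodule.span ℂ
    {g : ℂ → ℂ | ∃ f ∈ polyFuns (r - 2).toNat,
      g = f - slAct r v Smat f ∨ g = f - slAct r v Tmat f}

lemma mono_mem_polyFuns {n k : ℕ} (h : k ≤ n) : (fun t : ℂ => t ^ k) ∈ polyFuns n :=
  ⟨X ^ k, by rw [degree_X_pow]; exact_mod_cast h, by funext t; simp⟩

lemma polyFuns_le {n : ℕ} {W : Submodule ℂ (ℂ → ℂ)}
    (h : ∀ k ≤ n, (fun t : ℂ => t ^ k) ∈ W) : polyFuns n ≤ W := by
  rintro f ⟨p, hp, rfl⟩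
  have : (fun t => p.eval t) = ∑ i ∈ Finset.range (n + 1), p.coeff i • (fun t : ℂ => t ^ i) := by
    funext t
    rw [eval_eq_sum_range' (n := n + 1) (Nat.lt_succ_of_le (natDegree_le_iff_degree_le.mpr hp))]
    simp
  rw [this]
  exact W.sum_mem fun i hi => W.smul_mem _ (h i (by simp at hi; omega))

lemma slAct_T (r : ℤ) (v : Matrix.SpecialLinearGroup (Fin 2) ℤ →* ℂˣ) (f : ℂ → ℂ) :
    slAct r v Tmat f = fun t => (v Tmat : ℂ) * f (t + 1) := by
  funext t; simp [slAct, Tmat]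

lemma slAct_S (r : ℤ) (v : Matrix.SpecialLinearGroup (Fin 2) ℤ →* ℂˣ) (f : ℂ → ℂ) :
    slAct r v Smat f = fun t => (v Smat : ℂ) * t ^ (r - 2) * f (-1 / t) := by
  funext t; simp [slAct, Smat]

lemma T_mem (r : ℤ) (v : Matrix.SpecialLinearGroup (Fin 2) ℤ →* ℂˣ) (k : ℕ)
    (hk : k ≤ (r - 2).toNat) :
    (fun t : ℂ => t ^ k - (v Tmat : ℂ) * (t + 1) ^ k) ∈ Wspan r v := by
  refine Submodule.subset_span ⟨_, mono_mem_polyFuns hk, Or.inr ?_⟩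
  rw [slAct_T]; rfl

lemma case_ne (r : ℤ) (v : Matrix.SpecialLinearGroup (Fin 2) ℤ →* ℂˣ) (h : v Tmat ≠ 1) :
    polyFuns (r - 2).toNat ≤ Wspan r v := by
  apply polyFuns_le
  intro k
  induction k using Nat.strong_induction_on with
  | _ k ih =>
  intro hk
  have h1 : (1 - (v Tmat : ℂ)) ≠ 0 := by
    intro h2; apply h; ext; simpa using (sub_eq_zero.mp h2).symm
  have h2 := T_mem r v k hk
  have h3 : (∑ i ∈ Finset.range k, ((v Tmat : ℂ) * (k.choose i : ℂ)) • (fun t : ℂ => t ^ i))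
      ∈ Wspan r v :=
    Submodule.sum_mem _ fun i hi => Submodule.smul_mem _ _
      (ih i (Finset.mem_range.mp hi) (by have := Finset.mem_range.mp hi; omega))
  have h4 := Submodule.smul_mem _ (1 - (v Tmat : ℂ))⁻¹ (Submodule.add_mem _ h2 h3)
  convert h4 using 1
  funext t
  simp only [Pi.smul_apply, Pi.add_apply, Finset.sum_apply, smul_eq_mul]
  rw [eq_inv_mul_iff_mul_eq₀ h1, add_pow, Finset.sum_range_succ, mul_add, Finset.mul_sum]
  have : ∀ i ∈ Finset.range k, (v Tmat : ℂ) * (t ^ i * 1 ^ (k - i) * (k.choose i : ℂ))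
    = (v Tmat : ℂ) * (k.choose i : ℂ) * t ^ i := fun i _ => by simp; ring
  rw [Finset.sum_congr rfl this]
  simp; ring

lemma case_eq (r : ℤ) (hr : 2 < r) (v : Matrix.SpecialLinearGroup (Fin 2) ℤ →* ℂˣ)
    (h : v Tmat = 1) : polyFuns (r - 2).toNat ≤ Wspan r v := by
  have low : ∀ k < (r - 2).toNat, (fun t : ℂ => t ^ k) ∈ Wspan r v := by
    intro k
    induction k using Nat.strong_induction_on with
    | _ k ih =>
    intro hk
    have h1 : (-((k : ℂ) + 1)) ≠ 0 := neg_ne_zero.mpr (Nat.cast_add_one_ne_zero k)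
    have h2 := T_mem r v (k + 1) hk
    have h3 : (∑ i ∈ Finset.range k, ((k + 1).choose i : ℂ) • (fun t : ℂ => t ^ i))
        ∈ Wspan r v :=
      Submodule.sum_mem _ fun i hi => Submodule.smul_mem _ _
        (ih i (Finset.mem_range.mp hi) (by have := Finset.mem_range.mp hi; omega))
    have h4 := Submodule.smul_mem _ (-((k : ℂ) + 1))⁻¹ (Submodule.add_mem _ h2 h3)
    convert h4 using 1
    funext t
    simp only [Pi.smul_apply, Pi.add_apply, Finset.sum_apply, smul_eq_mul]
    rw [eq_inv_mul_iff_mul_eq₀ h1, add_pow, Finset.sum_range_succ, Finset.sum_range_succ, h]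
    have : ∀ i ∈ Finset.range k, (t ^ i * 1 ^ (k + 1 - i) * ((k + 1).choose i : ℂ))
      = ((k + 1).choose i : ℂ) * t ^ i := fun i _ => by simp; ring
    rw [Finset.sum_congr rfl this]
    simp; ring
  apply polyFuns_le
  intro k hk
  rcases hk.lt_or_eq with hk | hk
  · exact low k hk
  have h0 := low 0 (by omega)
  have hS : (fun t : ℂ => t ^ 0) - slAct r v Smat (fun t : ℂ => t ^ 0) ∈ Wspan r v :=
    Submodule.subset_span ⟨_, mono_mem_polyFuns (Nat.zero_le _), Or.inl rfl⟩
  have h4 := Submodule.smul_mem _ (v Smat : ℂ)⁻¹ (Submodule.sub_mem _ h0 hS)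
  convert h4 using 1
  rw [slAct_S]
  funext t
  have : t ^ (r - 2) = t ^ k := by
    rw [← zpow_natCast]; congr 1; omega
  simp [this]

lemma v_trivial (v : Matrix.SpecialLinearGroup (Fin 2) ℤ →* ℂˣ)
    (hS : v Smat = 1) (hT : v Tmat = 1) : ∀ γ, v γ = 1 := by
  have : v = 1 := by
    apply MonoidHom.eq_of_eqOn_dense SpecialLinearGroup.SL2Z_generators
    rintro x (rfl | rfl)
    · exact hS
    · exact hT
  simp [this]

lemma const_of_mem {f : ℂ → ℂ} (hf : f ∈ polyFuns 0) : ∃ c : ℂ, f = fun _ => c := by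
  obtain ⟨p, hp, rfl⟩ := hf
  rw [eq_C_of_degree_le_zero hp]
  exact ⟨p.coeff 0, by simp⟩

lemma case_two (v : Matrix.SpecialLinearGroup (Fin 2) ℤ →* ℂˣ) (h : v Smat ≠ 1) :
    polyFuns 0 ≤ Wspan 2 v := by
  apply polyFuns_le
  intro k hk
  obtain rfl : k = 0 := by omega
  have h1 : (1 - (v Smat : ℂ)) ≠ 0 := by
    intro h2; apply h; ext; simpa using (sub_eq_zero.mp h2).symm
  have hS : (fun t : ℂ => t ^ 0) - slAct 2 v Smat (fun t : ℂ => t ^ 0) ∈ Wspan 2 v :=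
    Submodule.subset_span ⟨_, mono_mem_polyFuns (Nat.zero_le _), Or.inl rfl⟩
  have h4 := Submodule.smul_mem _ (1 - (v Smat : ℂ))⁻¹ hS
  convert h4 using 1
  rw [slAct_S]
  funext t
  simp [h1]

theorem stmt9 (r : ℤ) (hr : 2 ≤ r)
    (v : Matrix.SpecialLinearGroup (Fin 2) ℤ →* ℂˣ)
    (hv : v negI = (-1 : ℂˣ) ^ r) :
    ((r = 2 ∧ ∀ γ, v γ = 1) →
      Module.finrank ℂ
        (↥(polyFuns (r - 2).toNat) ⧸
          (Submodule.comap (polyFuns (r - 2).toNat).subtype (Wspan r v))) = 1) ∧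
    (¬(r = 2 ∧ ∀ γ, v γ = 1) →
      Subsingleton
        (↥(polyFuns (r - 2).toNat) ⧸
          (Submodule.comap (polyFuns (r - 2).toNat).subtype (Wspan r v)))) := by
  refine ⟨?_, ?_⟩
  · rintro ⟨rfl, hv1⟩
    have hW : Wspan 2 v = ⊥ := by
      rw [Wspan, Submodule.span_eq_bot]
      rintro g ⟨f, hf, hg⟩
      obtain ⟨c, rfl⟩ := const_of_mem hf
      rw [slAct_S, slAct_T] at hg
      rcases hg with rfl | rfl <;> funext t <;> simp [hv1]
    have hb : Submodule.comap (polyFuns (2 - 2 : ℤ).toNat).subtype (Wspan 2 v) = ⊥ := by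
      rw [hW, Submodule.comap_bot, Submodule.ker_subtype]
    rw [(Submodule.quotEquivOfEqBot _ hb).finrank_eq]
    refine finrank_eq_one ⟨fun t : ℂ => t ^ 0, mono_mem_polyFuns (Nat.zero_le _)⟩ ?_ ?_
    · intro h
      have := congrFun (congrArg Subtype.val h) 0
      simp at this
    · rintro ⟨w, hw⟩
      obtain ⟨c, rfl⟩ := const_of_mem hw
      exact ⟨c, by ext t; simp⟩
  · intro hn
    rw [Submodule.Quotient.subsingleton_iff, Submodule.comap_subtype_eq_top]
    by_cases hT : v Tmat = 1
    · rcases hr.lt_or_eq with h2 | rfl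
      · exact case_eq r h2 v hT
      · exact case_two v fun hS => hn ⟨rfl, v_trivial v hS hT⟩
    · exact case_ne r v hT
end
end

section
/- Let r₁ ∈ ℝ and let f₁ : ℍ → ℂ be holomorphic with f₁(−1/z) = ε₁·z^{r₁}·f₁(z) and f₁(z+1) = δ₁·f₁(z) for all z ∈ ℍ, where ε₁, δ₁ ∈ ℂ ∖ {0} and the power is principal. For t ∈ ℍ⁻ define Q(t) := ∫_{τ ∈ segment[ρ, conj(t)]} f₁(τ)·(τ−t)^{r₁−2} dτ and P(t) := ∫_{τ ∈ segment[ρ−1, ρ]} f₁(τ)·(τ−t)^{r₁−2} dτ (principal powers; note Im(τ−t) > 0 throughout, so the integrands are well defined and continuous). Then for all t ∈ ℍ⁻: (i) δ₁^{−1}·Q(t+1) − Q(t) = P(t), and (ii) ε₁^{−1}·t^{r₁−2}·Q(−1/t) − Q(t) = P(t) (principal power of t, which has argument in (−π,0)). -/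
open Complex MeasureTheory Filter Set

noncomputable section

/-- Integral of `f` over the straight segment from `a` to `b`. -/
def segInt (a b : ℂ) (f : ℂ → ℂ) : ℂ :=
  (b - a) * ∫ t in (0:ℝ)..1, f (a + (t : ℂ) * (b - a))

/-- `ρ = e^{iπ/3}`. -/
def ρ : ℂ := (1 + Complex.I * Real.sqrt 3) / 2

/-- `Q(t) = ∫_{segment[ρ, conj t]} f₁(τ)·(τ−t)^{r₁−2} dτ` for `t` in the lower half-plane. -/
def Qpot (r₁ : ℝ) (f₁ : ℂ → ℂ) (t : ℂ) : ℂ :=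
  segInt ρ ((starRingEnd ℂ) t) (fun τ => f₁ τ * (τ - t) ^ ((r₁ - 2 : ℝ) : ℂ))

/-- `P(t) = ∫_{segment[ρ−1, ρ]} f₁(τ)·(τ−t)^{r₁−2} dτ`. -/
def Ppot (r₁ : ℝ) (f₁ : ℂ → ℂ) (t : ℂ) : ℂ :=
  segInt (ρ - 1) ρ (fun τ => f₁ τ * (τ - t) ^ ((r₁ - 2 : ℝ) : ℂ))


lemma segInt_eq {g G : ℂ → ℂ} (hG : ∀ z : ℂ, 0 < z.im → HasDerivAt G (g z) z)
    (hg : ContinuousOn g {z : ℂ | 0 < z.im}) {a b : ℂ} (ha : 0 < a.im) (hb : 0 < b.im) :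
    segInt a b g = G b - G a := by
  have hmem : ∀ x ∈ uIcc (0:ℝ) 1, 0 < (a + (x : ℂ) * (b - a)).im := by
    intro x hx
    rw [uIcc_of_le zero_le_one] at hx
    have : (a + (x : ℂ) * (b - a)).im = (1 - x) * a.im + x * b.im := by
      simp; ring
    rw [this]
    rcases eq_or_lt_of_le hx.1 with h | h
    · rw [← h]; simpa using ha
    · have := mul_pos h hb
      have := mul_nonneg (sub_nonneg.2 hx.2) ha.le
      linarith
  have hd : ∀ x ∈ uIcc (0:ℝ) 1, HasDerivAt (fun x : ℝ => G (a + (x : ℂ) * (b - a)))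
      ((b - a) * g (a + (x : ℂ) * (b - a))) x := by
    intro x hx
    have h1 : HasDerivAt (fun z : ℂ => a + z * (b - a)) (b - a) (x : ℂ) := by
      simpa using ((hasDerivAt_id (x : ℂ)).mul_const (b - a)).const_add a
    have h2 := (hG _ (hmem x hx)).comp (x : ℂ) h1
    have h3 := h2.comp_ofReal
    rw [mul_comm]
    exact h3
  have hc : ContinuousOn (fun x : ℝ => (b - a) * g (a + (x : ℂ) * (b - a))) (uIcc (0:ℝ) 1) := by
    refine continuousOn_const.mul (hg.comp (by fun_prop) hmem)
  have := intervalIntegral.integral_eq_sub_of_hasDerivAt hd hc.intervalIntegrable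
  unfold segInt
  rw [← intervalIntegral.integral_const_mul, this]
  simp

lemma arg_up {z : ℂ} (hz : 0 < z.im) : 0 < arg z ∧ arg z < Real.pi := by
  constructor
  · refine lt_of_le_of_ne (arg_nonneg_iff.2 hz.le) fun h => ?_
    have := (arg_eq_zero_iff.1 h.symm).2
    linarith
  · exact arg_lt_pi_iff.2 (Or.inr hz.ne')

lemma cpow_triple {w t u v : ℂ} (hw : 0 < w.im) (ht : t.im < 0) (hu : 0 < u.im) (hv : 0 < v.im)
    (h : v = w * t * u) (s : ℂ) : v ^ s = w ^ s * t ^ s * u ^ s := by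
  have ne {z : ℂ} (hz : z.im ≠ 0) : z ≠ 0 := by rintro rfl; simp at hz
  have hw0 := ne hw.ne'
  have ht0 := ne ht.ne
  have hu0 := ne hu.ne'
  have hv0 := ne hv.ne'
  have hl : log v = log w + log t + log u := by
    have he : exp (log v) = exp (log w + log t + log u) := by
      rw [exp_add, exp_add, exp_log hw0, exp_log ht0, exp_log hu0, exp_log hv0, h]
    obtain ⟨n, hn⟩ := exp_eq_exp_iff_exists_int.1 he
    have him := congrArg im hn
    have h2 : ((n : ℂ) * (2 * Real.pi * I)).im = n * (2 * Real.pi) := by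
      simp
    rw [add_im, add_im, add_im, h2, log_im, log_im, log_im, log_im] at him
    have a1 := arg_up hw
    have a2 := arg_neg_iff.2 ht
    have a2' := neg_pi_lt_arg t
    have a3 := arg_up hu
    have a4 := arg_up hv
    have hpi := Real.pi_pos
    have n1 : (n : ℝ) < 1 := by
      by_contra hcon
      push Not at hcon
      nlinarith
    have n2 : (-1 : ℝ) < n := by
      by_contra hcon
      push Not at hcon
      nlinarith
    have n1' : n < 1 := by exact_mod_cast n1
    have n2' : -1 < n := by exact_mod_cast n2
    have : n = 0 := by omega
    rw [hn, this]; simp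
  rw [cpow_def_of_ne_zero hw0, cpow_def_of_ne_zero ht0, cpow_def_of_ne_zero hu0,
    cpow_def_of_ne_zero hv0, hl, ← exp_add, ← exp_add]
  ring_nf

lemma neg_inv_im_eq (z : ℂ) : (-1 / z).im = z.im / normSq z := by
  rw [neg_div, one_div, neg_im, inv_im]; ring

lemma rho_im : 0 < ρ.im := by
  simp [ρ]

lemma rho_inv : -1 / ρ = ρ - 1 := by
  have h0 : ρ ≠ 0 := by
    intro h; have := rho_im; rw [h] at this; simp at this
  have hs : ((Real.sqrt 3 : ℝ) : ℂ) ^ 2 = 3 := by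
    rw [← ofReal_pow, Real.sq_sqrt (by norm_num)]; norm_num
  rw [div_eq_iff h0]
  unfold ρ
  linear_combination (-1/4 : ℂ) * (I ^ 2 * hs + 3 * I_sq)

lemma integrand_diff (r₁ : ℝ) (f₁ : ℂ → ℂ)
    (hf₁ : DifferentiableOn ℂ f₁ {z : ℂ | 0 < z.im}) {t : ℂ} (ht : t.im < 0) :
    DifferentiableOn ℂ (fun τ => f₁ τ * (τ - t) ^ ((r₁ - 2 : ℝ) : ℂ)) {z : ℂ | 0 < z.im} := by
  refine hf₁.mul ?_
  intro z hz
  have hz : 0 < z.im := hz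
  refine DifferentiableAt.differentiableWithinAt ?_
  refine DifferentiableAt.cpow (by fun_prop) (by fun_prop) (Or.inr ?_)
  rw [sub_im]
  exact (by linarith : 0 < z.im - t.im).ne'

theorem stmt11 (r₁ : ℝ) (f₁ : ℂ → ℂ)
    (hf₁ : DifferentiableOn ℂ f₁ {z : ℂ | 0 < z.im})
    (ε₁ δ₁ : ℂ) (hε₁ : ε₁ ≠ 0) (hδ₁ : δ₁ ≠ 0)
    (hS : ∀ z : ℂ, 0 < z.im → f₁ (-1 / z) = ε₁ * z ^ ((r₁ : ℝ) : ℂ) * f₁ z)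
    (hT : ∀ z : ℂ, 0 < z.im → f₁ (z + 1) = δ₁ * f₁ z) :
    ∀ t : ℂ, t.im < 0 →
      (δ₁⁻¹ * Qpot r₁ f₁ (t + 1) - Qpot r₁ f₁ t = Ppot r₁ f₁ t) ∧
      (ε₁⁻¹ * t ^ ((r₁ - 2 : ℝ) : ℂ) * Qpot r₁ f₁ (-1 / t) - Qpot r₁ f₁ t =
        Ppot r₁ f₁ t) := by
  intro t ht
  have hopen : IsOpen {z : ℂ | 0 < z.im} := isOpen_lt continuous_const continuous_im
  have hg := integrand_diff r₁ f₁ hf₁ ht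
  obtain ⟨G, hG'⟩ := (convex_halfSpace_im_gt 0).exists_forall_hasDerivWithinAt hg
  have hG : ∀ z : ℂ, 0 < z.im →
      HasDerivAt G (f₁ z * (z - t) ^ ((r₁ - 2 : ℝ) : ℂ)) z :=
    fun z hz => (hG' z hz).hasDerivAt (hopen.mem_nhds hz)
  have hρ := rho_im
  have hρ1 : 0 < (ρ - 1).im := by simpa using hρ
  have hct : 0 < ((starRingEnd ℂ) t).im := by simpa using ht
  have hQ : Qpot r₁ f₁ t = G ((starRingEnd ℂ) t) - G ρ := segInt_eq hG hg.continuousOn hρ hct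
  have hP : Ppot r₁ f₁ t = G ρ - G (ρ - 1) := segInt_eq hG hg.continuousOn hρ1 hρ
  have t0 : t ≠ 0 := by rintro rfl; simp at ht
  constructor
  · have ht1 : (t + 1).im < 0 := by simpa using ht
    have hH : ∀ z : ℂ, 0 < z.im → HasDerivAt (fun z => δ₁ * G (z - 1))
        (f₁ z * (z - (t + 1)) ^ ((r₁ - 2 : ℝ) : ℂ)) z := by
      intro z hz
      have hz1 : 0 < (z - 1).im := by simpa using hz
      have h1 := ((hG _ hz1).comp_sub_const z 1).const_mul δ₁
      refine HasDerivAt.congr_deriv h1 ?_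
      have := hT _ hz1
      rw [sub_add_cancel] at this
      rw [this, show z - (t + 1) = z - 1 - t by ring]
      ring
    have hQ1 : Qpot r₁ f₁ (t + 1) = _ :=
      segInt_eq hH (integrand_diff r₁ f₁ hf₁ ht1).continuousOn hρ (by simpa using ht)
    rw [hQ1, hQ, hP]
    simp only [map_add, map_one, add_sub_cancel_right]
    field_simp
    ring
  · have hN : 0 < normSq t := normSq_pos.2 t0
    have ht1 : (-1 / t).im < 0 := by
      rw [neg_inv_im_eq]; exact div_neg_of_neg_of_pos ht hN
    have hts : t ^ ((r₁ - 2 : ℝ) : ℂ) ≠ 0 := by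
      rw [cpow_def_of_ne_zero t0]; exact exp_ne_zero _
    have hH : ∀ z : ℂ, 0 < z.im →
        HasDerivAt (fun z => (ε₁ * (t ^ ((r₁ - 2 : ℝ) : ℂ))⁻¹) * G (-1 / z))
        (f₁ z * (z - (-1 / t)) ^ ((r₁ - 2 : ℝ) : ℂ)) z := by
      intro z hz
      have z0 : z ≠ 0 := by rintro rfl; simp at hz
      have hw : 0 < (-1 / z).im := by
        rw [neg_inv_im_eq]; exact div_pos hz (normSq_pos.2 z0)
      have w0 : -1 / z ≠ 0 := div_ne_zero (by norm_num) z0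
      have hi : HasDerivAt (fun z : ℂ => -1 / z) (1 / z ^ 2) z := by
        have := (hasDerivAt_inv z0).const_mul (-1)
        have h2 : HasDerivAt (fun z : ℂ => -1 / z) (-1 * -(z ^ 2)⁻¹) z := by
          simpa only [div_eq_mul_inv] using this
        refine HasDerivAt.congr_deriv h2 ?_
        field_simp
      have h1 := ((hG _ hw).comp z hi).const_mul (ε₁ * (t ^ ((r₁ - 2 : ℝ) : ℂ))⁻¹)
      refine HasDerivAt.congr_deriv h1 ?_
      have hfz := hS _ hw
      rw [show -1 / (-1 / z) = z by field_simp] at hfz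
      have hcp := cpow_triple (v := -1 / z - t) (u := z - (-1 / t)) hw ht
        (by rw [sub_im]; linarith) (by rw [sub_im]; linarith) (by field_simp; ring)
        ((r₁ - 2 : ℝ) : ℂ)
      have hpw : (-1 / z) ^ ((r₁ : ℝ) : ℂ) = (-1 / z) ^ ((r₁ - 2 : ℝ) : ℂ) * (1 / z ^ 2) := by
        rw [show ((r₁ : ℝ) : ℂ) = ((r₁ - 2 : ℝ) : ℂ) + (2 : ℕ) by push_cast; ring,
          cpow_add _ _ w0, cpow_natCast]
        congr 1
        field_simp
      rw [hfz, hcp, hpw]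
      field_simp
    have hQ1 : Qpot r₁ f₁ (-1 / t) = _ :=
      segInt_eq hH (integrand_diff r₁ f₁ hf₁ ht1).continuousOn hρ
        (by rw [conj_im]; linarith)
    have hcc : -1 / (starRingEnd ℂ) (-1 / t) = (starRingEnd ℂ) t := by
      have : (starRingEnd ℂ) t ≠ 0 := by simpa using t0
      rw [map_div₀, map_neg, map_one]
      field_simp
    rw [hQ1, hQ, hP]
    simp only [hcc, rho_inv]
    field_simp
    ring
end
end

section
/- Let μ₁ ∈ ℝ, μ₂ > 0, μ₃ ≥ 0 be real numbers and let r₁ < 2 and r₂ < 2 be real. Then all integrals below converge absolutely and ∫_{τ₁ ∈ segment[ρ−1,ρ]} e^{2πi·μ₁·τ₁}·( i·∫_{y=1}^{∞} e^{−2π·μ₂·y}·[∫_{u=0}^{1} e^{2πi·μ₃·(τ₁+u(iy−τ₁))}·u^{1−r₂}·(1−u)^{1−r₁} du] dy ) dτ₁ = (i/(2π))·e^{−2π·μ₂ − π√3·(μ₁+μ₃)}·∫_{u=0}^{1} u^{1−r₂}·(1−u)^{1−r₁}·e^{−π(2−√3)·μ₃·u}·sinc(π(μ₁+(1−u)μ₃))/(μ₂+μ₃·u)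 du, where sinc(x) := sin(x)/x for x ≠ 0 and sinc(0) := 1, and u^{1−r₂}, (1−u)^{1−r₁} are real powers. -/
open Complex MeasureTheory Filter Set

noncomputable section

/-- `sinc x = sin x / x`, with `sinc 0 = 1`. -/
def sinc (x : ℝ) : ℝ := if x = 0 then 1 else Real.sin x / x

/-- The weight as a complex valued function is integrable. -/
lemma weight_integrable (r₁ r₂ : ℝ) (hr₁ : r₁ < 2) (hr₂ : r₂ < 2) :
    IntervalIntegrable (fun u : ℝ =>
      ((u ^ (1 - r₂) : ℝ) : ℂ) * (((1 - u) ^ (1 - r₁) : ℝ) : ℂ)) volume 0 1 := by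
  have h := Complex.betaIntegral_convergent (u := ((2 - r₂ : ℝ) : ℂ)) (v := ((2 - r₁ : ℝ) : ℂ))
    (by rw [ofReal_re]; linarith) (by rw [ofReal_re]; linarith)
  refine h.congr ?_
  intro u hu
  rw [uIoc_of_le zero_le_one] at hu
  have e1 : ((2 - r₂ : ℝ) : ℂ) - 1 = ((1 - r₂ : ℝ) : ℂ) := by push_cast; ring
  have e2 : ((2 - r₁ : ℝ) : ℂ) - 1 = ((1 - r₁ : ℝ) : ℂ) := by push_cast; ring
  have e3 : (1 : ℂ) - (u : ℂ) = ((1 - u : ℝ) : ℂ) := by push_cast; ring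
  simp only [e1, e2, e3]
  rw [ofReal_cpow hu.1.le, ofReal_cpow (by linarith [hu.2])]

lemma rho_re : ρ.re = 1 / 2 := by
  simp [ρ]

lemma rho_im_s14 : ρ.im = Real.sqrt 3 / 2 := by
  simp [ρ]

lemma seg_im {τ : ℂ} (h : τ ∈ segment ℝ (ρ - 1) ρ) : 0 ≤ τ.im := by
  obtain ⟨a, b, ha, hb, hab, rfl⟩ := h
  have := Real.sqrt_nonneg 3
  simp [rho_im_s14]
  positivity

lemma sinc_cont : Continuous sinc := Real.continuous_sinc

/-- Joint integrability in `(y, u)`. -/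
lemma joint_integrable (μ₂ μ₃ : ℝ) (hμ₂ : 0 < μ₂) (hμ₃ : 0 ≤ μ₃)
    (r₁ r₂ : ℝ) (hr₁ : r₁ < 2) (hr₂ : r₂ < 2) (τ₁ : ℂ) (hτ : 0 ≤ τ₁.im) :
    Integrable (Function.uncurry (fun y u : ℝ =>
        ((Real.exp (-2 * Real.pi * μ₂ * y) : ℝ) : ℂ) *
            (Complex.exp (2 * (Real.pi : ℂ) * Complex.I * (μ₃ : ℂ) *
                (τ₁ + (u : ℂ) * (Complex.I * (y : ℂ) - τ₁))) *
              ((u ^ (1 - r₂) : ℝ) : ℂ) * (((1 - u) ^ (1 - r₁) : ℝ) : ℂ))))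
      ((volume.restrict (Ioi (1 : ℝ))).prod (volume.restrict (Ioc (0 : ℝ) 1))) := by
  have hw := (weight_integrable r₁ r₂ hr₁ hr₂).1
  have hy : IntegrableOn (fun y : ℝ => ((Real.exp (-2 * Real.pi * μ₂ * y) : ℝ) : ℂ)) (Ioi 1) :=
    (integrableOn_exp_mul_Ioi (a := -2 * Real.pi * μ₂)
      (by have := mul_pos Real.pi_pos hμ₂; nlinarith) 1).ofReal
  have hp := Integrable.mul_prod hy hw
  have hb := hp.bdd_mul (c := 1)
    (f := fun z : ℝ × ℝ => Complex.exp (2 * (Real.pi : ℂ) * Complex.I * (μ₃ : ℂ) *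
                (τ₁ + (z.2 : ℂ) * (Complex.I * (z.1 : ℂ) - τ₁))))
    (by apply Continuous.aestronglyMeasurable; fun_prop)
    (by
      rw [Measure.prod_restrict]
      refine (ae_restrict_mem (measurableSet_Ioi.prod measurableSet_Ioc)).mono ?_
      rintro ⟨y, u⟩ ⟨hy, hu⟩
      simp only [mem_Ioi, mem_Ioc] at hy hu
      rw [Complex.norm_exp, Real.exp_le_one_iff]
      have : (2 * (Real.pi : ℂ) * Complex.I * (μ₃ : ℂ) *
                (τ₁ + (u : ℂ) * (Complex.I * (y : ℂ) - τ₁))).re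
          = -(2 * Real.pi * μ₃ * ((1 - u) * τ₁.im + u * y)) := by
        simp only [Complex.mul_re, Complex.mul_im, Complex.add_re, Complex.add_im, Complex.sub_re,
          Complex.sub_im, Complex.I_re, Complex.I_im, ofReal_re, ofReal_im, Complex.re_ofNat,
          Complex.im_ofNat]
        ring
      rw [this]
      have h1 : 0 ≤ 1 - u := by linarith
      have h2 : 0 ≤ y := by linarith
      have h3 := hu.1.le
      have h4 := Real.pi_pos.le
      have : 0 ≤ 2 * Real.pi * μ₃ * ((1 - u) * τ₁.im + u * y) := by positivity
      linarith)
  refine hb.congr (Filter.Eventually.of_forall ?_)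
  rintro ⟨y, u⟩
  simp only [Function.uncurry]
  ring

/-- The `y`-integral. -/
lemma y_int (μ₂ μ₃ u : ℝ) (hpos : 0 < μ₂ + μ₃ * u) (τ A B : ℂ) :
    ∫ y in Ioi (1 : ℝ), ((Real.exp (-2 * Real.pi * μ₂ * y) : ℝ) : ℂ) *
            (Complex.exp (2 * (Real.pi : ℂ) * Complex.I * (μ₃ : ℂ) *
                (τ + (u : ℂ) * (Complex.I * (y : ℂ) - τ))) * A * B)
      = Complex.exp (2 * (Real.pi : ℂ) * Complex.I * (μ₃ : ℂ) * ((1 - u) * τ)) * A * B *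
        (Complex.exp (-(2 * Real.pi * (μ₂ + μ₃ * u))) / (2 * Real.pi * (μ₂ + μ₃ * u))) := by
  have hre : (-(2 * Real.pi * (μ₂ + μ₃ * u)) : ℂ).re < 0 := by
    have : (-(2 * Real.pi * (μ₂ + μ₃ * u)) : ℂ) = ((-(2 * Real.pi * (μ₂ + μ₃ * u)) : ℝ) : ℂ) := by
      push_cast; ring
    rw [this, ofReal_re]
    have := mul_pos Real.pi_pos hpos
    linarith
  have h := integral_exp_mul_complex_Ioi hre 1
  rw [ofReal_one, mul_one, neg_div_neg_eq] at h
  rw [← h, ← integral_const_mul]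
  congr 1
  ext y
  rw [ofReal_exp]
  have : ∀ a b c d : ℂ, a * (b * A * B) = c * A * B * d ↔ (a * b) * (A * B) = (c * d) * (A * B) := by
    intro a b c d
    constructor <;> intro h <;> linear_combination h
  rw [this, ← Complex.exp_add, ← Complex.exp_add]
  congr 2
  push_cast
  linear_combination (2 * Real.pi * μ₃ * u * y : ℂ) * Complex.I_sq

/-- The `t`-integral. -/
lemma t_int (ν : ℝ) :
    ∫ t in (0:ℝ)..1, Complex.exp (2 * (Real.pi : ℂ) * Complex.I * (ν : ℂ) *
        (ρ - 1 + (t : ℂ) * (ρ - (ρ - 1))))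
      = ((Real.exp (-(Real.pi * Real.sqrt 3 * ν)) * sinc (Real.pi * ν) : ℝ) : ℂ) := by
  by_cases hν : ν = 0
  · simp [hν, sinc]
  have hpi : (Real.pi : ℂ) ≠ 0 := by exact_mod_cast Real.pi_ne_zero
  have hν' : (ν : ℂ) ≠ 0 := by exact_mod_cast hν
  have hc : (2 * (Real.pi : ℂ) * Complex.I * (ν : ℂ)) ≠ 0 := by
    simp [hν, Real.pi_ne_zero]
  have h1 : ∀ t : ℝ, Complex.exp (2 * (Real.pi : ℂ) * Complex.I * (ν : ℂ) *
        (ρ - 1 + (t : ℂ) * (ρ - (ρ - 1)))) =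
      Complex.exp (2 * (Real.pi : ℂ) * Complex.I * (ν : ℂ) * (ρ - 1)) *
      Complex.exp (2 * (Real.pi : ℂ) * Complex.I * (ν : ℂ) * t) := by
    intro t
    rw [← Complex.exp_add]
    congr 1
    ring
  simp_rw [h1]
  rw [intervalIntegral.integral_const_mul, integral_exp_mul_complex hc]
  have h2 : Complex.exp (2 * (Real.pi : ℂ) * Complex.I * (ν : ℂ) * (ρ - 1)) =
      Complex.exp (-(Real.pi * Real.sqrt 3 * ν)) * Complex.exp (-(Real.pi * ν) * I) := by
    rw [← Complex.exp_add]
    congr 1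
    unfold ρ
    linear_combination (Real.pi * Real.sqrt 3 * ν : ℂ) * Complex.I_sq
  have h3 : sinc (Real.pi * ν) = Real.sin (Real.pi * ν) / (Real.pi * ν) := by
    unfold sinc
    rw [if_neg (mul_ne_zero Real.pi_ne_zero hν)]
  have h4 : Complex.exp (2 * (Real.pi : ℂ) * Complex.I * (ν : ℂ) * (1 : ℝ)) =
      Complex.exp ((Real.pi * ν) * I) * Complex.exp ((Real.pi * ν) * I) := by
    rw [← Complex.exp_add]
    congr 1
    push_cast
    ring
  have h5 : Complex.exp (-(Real.pi * ν) * I) * Complex.exp ((Real.pi * ν) * I) = 1 := by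
    rw [← Complex.exp_add]
    simp
  rw [h2, h3, h4]
  push_cast
  rw [Complex.sin, mul_zero, Complex.exp_zero]
  generalize Complex.exp (-(Real.pi * ν) * I) = a at *
  generalize Complex.exp ((Real.pi * ν) * I) = b at *
  field_simp
  linear_combination b * h5 + (b - a) * Complex.I_sq

theorem stmt14 (μ₁ μ₂ μ₃ : ℝ) (hμ₂ : 0 < μ₂) (hμ₃ : 0 ≤ μ₃)
    (r₁ r₂ : ℝ) (hr₁ : r₁ < 2) (hr₂ : r₂ < 2) :
    -- the innermost u-integral converges absolutely
    (∀ τ₁ ∈ segment ℝ (ρ - 1) ρ, ∀ y : ℝ, 1 ≤ y →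
      IntervalIntegrable (fun u : ℝ =>
        Complex.exp (2 * (Real.pi : ℂ) * Complex.I * (μ₃ : ℂ) *
            (τ₁ + (u : ℂ) * (Complex.I * (y : ℂ) - τ₁))) *
          ((u ^ (1 - r₂) : ℝ) : ℂ) * (((1 - u) ^ (1 - r₁) : ℝ) : ℂ)) volume 0 1) ∧
    -- the y-integral converges absolutely
    (∀ τ₁ ∈ segment ℝ (ρ - 1) ρ,
      IntegrableOn (fun y : ℝ =>
        ((Real.exp (-2 * Real.pi * μ₂ * y) : ℝ) : ℂ) *
          ∫ u in (0:ℝ)..1,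
            Complex.exp (2 * (Real.pi : ℂ) * Complex.I * (μ₃ : ℂ) *
                (τ₁ + (u : ℂ) * (Complex.I * (y : ℂ) - τ₁))) *
              ((u ^ (1 - r₂) : ℝ) : ℂ) * (((1 - u) ^ (1 - r₁) : ℝ) : ℂ)) (Set.Ioi 1)) ∧
    -- the u-integral on the right converges absolutely
    IntervalIntegrable (fun u : ℝ =>
      u ^ (1 - r₂) * (1 - u) ^ (1 - r₁) *
        Real.exp (-(Real.pi * (2 - Real.sqrt 3) * μ₃ * u)) *
        sinc (Real.pi * (μ₁ + (1 - u) * μ₃)) / (μ₂ + μ₃ * u)) volume 0 1 ∧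
    -- the evaluation of the triple integral on a triple of Fourier terms
    segInt (ρ - 1) ρ (fun τ₁ =>
        Complex.exp (2 * (Real.pi : ℂ) * Complex.I * (μ₁ : ℂ) * τ₁) *
          (Complex.I * ∫ y in Set.Ioi (1 : ℝ),
            ((Real.exp (-2 * Real.pi * μ₂ * y) : ℝ) : ℂ) *
              ∫ u in (0:ℝ)..1,
                Complex.exp (2 * (Real.pi : ℂ) * Complex.I * (μ₃ : ℂ) *
                    (τ₁ + (u : ℂ) * (Complex.I * (y : ℂ) - τ₁))) *
                  ((u ^ (1 - r₂) : ℝ) : ℂ) * (((1 - u) ^ (1 - r₁) : ℝ) : ℂ))) =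
      (Complex.I / (2 * (Real.pi : ℂ))) *
        ((Real.exp (-2 * Real.pi * μ₂ - Real.pi * Real.sqrt 3 * (μ₁ + μ₃)) : ℝ) : ℂ) *
        ((∫ u in (0:ℝ)..1,
            u ^ (1 - r₂) * (1 - u) ^ (1 - r₁) *
              Real.exp (-(Real.pi * (2 - Real.sqrt 3) * μ₃ * u)) *
              sinc (Real.pi * (μ₁ + (1 - u) * μ₃)) / (μ₂ + μ₃ * u) : ℝ) : ℂ) := by
  have hw := weight_integrable r₁ r₂ hr₁ hr₂
  have hpos : ∀ u ∈ Icc (0:ℝ) 1, 0 < μ₂ + μ₃ * u := fun u hu => by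
    have := mul_nonneg hμ₃ hu.1
    linarith
  refine ⟨?_, ?_, ?_, ?_⟩
  · intro τ₁ _ y _
    have := hw.continuousOn_mul (g := fun u : ℝ => Complex.exp (2 * (Real.pi : ℂ) * Complex.I *
      (μ₃ : ℂ) * (τ₁ + (u : ℂ) * (Complex.I * (y : ℂ) - τ₁)))) (by fun_prop)
    simpa only [mul_assoc] using this
  · intro τ₁ hτ
    have := (joint_integrable μ₂ μ₃ hμ₂ hμ₃ r₁ r₂ hr₁ hr₂ τ₁ (seg_im hτ)).integral_prod_left
    refine this.congr (Filter.Eventually.of_forall fun y => ?_)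
    simp only [Function.uncurry]
    rw [integral_const_mul, intervalIntegral.integral_of_le zero_le_one]
  · have hwr : IntervalIntegrable (fun u : ℝ => u ^ (1 - r₂) * (1 - u) ^ (1 - r₁))
        volume 0 1 := by
      have h1 := hw.1.re
      refine ⟨h1.congr (Filter.Eventually.of_forall fun u => ?_), by simp⟩
      simp only [← ofReal_mul]
      exact ofReal_re _
    have := hwr.continuousOn_mul (g := fun u : ℝ =>
      Real.exp (-(Real.pi * (2 - Real.sqrt 3) * μ₃ * u)) *
        sinc (Real.pi * (μ₁ + (1 - u) * μ₃)) / (μ₂ + μ₃ * u)) (by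
        rw [uIcc_of_le zero_le_one]
        refine ContinuousOn.div ?_ (by fun_prop) fun u hu => (hpos u hu).ne'
        have := sinc_cont
        fun_prop)
    refine this.congr fun u _ => ?_
    ring
  · have hτ : ∀ t ∈ Icc (0:ℝ) 1, 0 ≤ (ρ - 1 + (t : ℂ) * (ρ - (ρ - 1))).im := by
      intro t _
      have := Real.sqrt_nonneg 3
      simp [rho_im_s14]
      positivity
    unfold segInt
    set W : ℝ → ℂ := fun u => ((u ^ (1 - r₂) : ℝ) : ℂ) * (((1 - u) ^ (1 - r₁) : ℝ) : ℂ) with hW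
    set H : ℝ → ℝ → ℂ := fun t u =>
      Complex.exp (2 * (Real.pi : ℂ) * Complex.I * ((μ₁ + (1 - u) * μ₃ : ℝ) : ℂ) *
        (ρ - 1 + (t : ℂ) * (ρ - (ρ - 1)))) *
      (I * (Complex.exp (-(2 * Real.pi * (μ₂ + μ₃ * u))) / (2 * Real.pi * (μ₂ + μ₃ * u)))) with hH
    have hne : ∀ u ∈ Icc (0:ℝ) 1, (2 * Real.pi * (μ₂ + μ₃ * u) : ℂ) ≠ 0 := by
      intro u hu
      have : (2 * Real.pi * (μ₂ + μ₃ * u) : ℂ) = ((2 * Real.pi * (μ₂ + μ₃ * u) : ℝ) : ℂ) := by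
        push_cast; ring
      rw [this, ofReal_ne_zero]
      exact (mul_pos Real.two_pi_pos (hpos u hu)).ne'
    have step1 : ∀ t ∈ uIcc (0:ℝ) 1,
        Complex.exp (2 * (Real.pi : ℂ) * Complex.I * (μ₁ : ℂ) * (ρ - 1 + (t : ℂ) * (ρ - (ρ - 1)))) *
          (Complex.I * ∫ y in Set.Ioi (1 : ℝ),
            ((Real.exp (-2 * Real.pi * μ₂ * y) : ℝ) : ℂ) *
              ∫ u in (0:ℝ)..1,
                Complex.exp (2 * (Real.pi : ℂ) * Complex.I * (μ₃ : ℂ) *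
                    ((ρ - 1 + (t : ℂ) * (ρ - (ρ - 1))) + (u : ℂ) *
                      (Complex.I * (y : ℂ) - (ρ - 1 + (t : ℂ) * (ρ - (ρ - 1)))))) *
                  ((u ^ (1 - r₂) : ℝ) : ℂ) * (((1 - u) ^ (1 - r₁) : ℝ) : ℂ))
          = ∫ u in (0:ℝ)..1, H t u * W u := by
      intro t ht
      rw [uIcc_of_le zero_le_one] at ht
      have hj := joint_integrable μ₂ μ₃ hμ₂ hμ₃ r₁ r₂ hr₁ hr₂ _ (hτ t ht)
      have hs := integral_integral_swap hj
      simp only [integral_const_mul] at hs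
      simp only [intervalIntegral.integral_of_le zero_le_one]
      rw [hs, ← integral_const_mul, ← integral_const_mul]
      refine setIntegral_congr_fun measurableSet_Ioc fun u hu => ?_
      rw [y_int μ₂ μ₃ u (hpos u ⟨hu.1.le, hu.2⟩)]
      simp only [hH, hW]
      have : Complex.exp (2 * (Real.pi : ℂ) * Complex.I * ((μ₁ + (1 - u) * μ₃ : ℝ) : ℂ) *
        (ρ - 1 + (t : ℂ) * (ρ - (ρ - 1)))) =
          Complex.exp (2 * (Real.pi : ℂ) * Complex.I * (μ₁ : ℂ) * (ρ - 1 + (t : ℂ) * (ρ - (ρ - 1)))) *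
          Complex.exp (2 * (Real.pi : ℂ) * Complex.I * (μ₃ : ℂ) *
            ((1 - u) * (ρ - 1 + (t : ℂ) * (ρ - (ρ - 1))))) := by
        rw [← Complex.exp_add]
        congr 1
        push_cast
        ring
      rw [this]
      ring
    rw [intervalIntegral.integral_congr step1]
    have hint : IntegrableOn (Function.uncurry fun t u => H t u * W u)
        (uIoc (0:ℝ) 1 ×ˢ uIoc (0:ℝ) 1) := by
      rw [uIoc_of_le zero_le_one]
      have hw2 : IntegrableOn W (Icc 0 1) := by
        rw [integrableOn_Icc_iff_integrableOn_Ioc]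
        exact hw.1
      have h1 : IntegrableOn (fun _ : ℝ => (1 : ℂ)) (Icc (0:ℝ) 1) :=
        continuousOn_const.integrableOn_Icc
      have hp := Integrable.mul_prod h1 hw2
      rw [Measure.prod_restrict, ← Measure.volume_eq_prod] at hp
      have hcont : ContinuousOn (Function.uncurry H) (Icc (0:ℝ) 1 ×ˢ Icc (0:ℝ) 1) := by
        simp only [hH, Function.uncurry_def]
        refine ContinuousOn.mul (by fun_prop) (ContinuousOn.mul (by fun_prop) ?_)
        exact ContinuousOn.div (by fun_prop) (by fun_prop) fun z hz => hne z.2 hz.2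
      have := IntegrableOn.continuousOn_mul hcont hp (isCompact_Icc.prod isCompact_Icc)
      refine (this.mono_set (prod_mono Ioc_subset_Icc_self Ioc_subset_Icc_self)).congr
        (Filter.Eventually.of_forall ?_)
      rintro ⟨t, u⟩
      simp [Function.uncurry]
    rw [intervalIntegral_intervalIntegral_swap hint, sub_sub_cancel, one_mul,
      ← intervalIntegral.integral_ofReal, ← intervalIntegral.integral_const_mul]
    refine intervalIntegral.integral_congr fun u hu => ?_
    rw [uIcc_of_le zero_le_one] at hu
    simp only [hH]
    rw [intervalIntegral.integral_mul_const, intervalIntegral.integral_mul_const, t_int]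
    simp only [hW]
    have h2 : (μ₂ + μ₃ * u : ℂ) ≠ 0 := by
      exact_mod_cast (hpos u hu).ne'
    have hpi : (Real.pi : ℂ) ≠ 0 := by exact_mod_cast Real.pi_ne_zero
    have key : Complex.exp (-(Real.pi * Real.sqrt 3 * (μ₁ + (1 - u) * μ₃))) *
        Complex.exp (-(2 * Real.pi * (μ₂ + μ₃ * u))) =
        Complex.exp (-2 * Real.pi * μ₂ - Real.pi * Real.sqrt 3 * (μ₁ + μ₃)) *
        Complex.exp (-(Real.pi * (2 - Real.sqrt 3) * μ₃ * u)) := by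
      rw [← Complex.exp_add, ← Complex.exp_add]
      congr 1
      ring
    generalize sinc (Real.pi * (μ₁ + (1 - u) * μ₃)) = S
    generalize u ^ (1 - r₂) = A
    generalize (1 - u) ^ (1 - r₁) = B
    push_cast
    have hD : (2 * Real.pi * (μ₂ + μ₃ * u) : ℂ)⁻¹ = (2 * Real.pi : ℂ)⁻¹ * (μ₂ + μ₃ * u : ℂ)⁻¹ :=
      mul_inv _ _
    simp only [div_eq_mul_inv, hD]
    linear_combination (S * I * (2 * Real.pi : ℂ)⁻¹ * (μ₂ + μ₃ * u : ℂ)⁻¹ * A * B) * key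
end
end
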